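/- arXiv:2203.02169 — 2 statements merged into one kernel-verified Lean document; each statement's English description precedes it below -/
import Mathlib

section
/- For every integer ℓ ≥ 2, every constant γ with 0 < γ < (ℓ−1)/(ℓ²+2ℓ), and all sufficiently large n, there exists an n-vertex K_{ℓ+1}-free graph G with α_ℓ(G) ≤ n^{1−γ}. -/
/-- The line with direction `(1,t,t²)` through `P`. -/
def lineOf {F : Type*} [Field F] (t : F) (P : F × F × F) : F × F :=
  (P.2.1 - t * P.1, P.2.2 - t ^ 2 * P.1)

/-- The graph of a colouring of the incidences. -/
def colGraph {F : Type*} [Field F] {ℓ : ℕ} (χ : F × (F × F × F) → Fin ℓ) :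
    SimpleGraph (F × F × F) where
  Adj P Q := ∃ t, lineOf t P = lineOf t Q ∧ χ (t, P) ≠ χ (t, Q)
  symm := ⟨fun _ _ ⟨t, h1, h2⟩ => ⟨t, h1.symm, h2.symm⟩⟩
  loopless := ⟨fun _ ⟨_, _, h2⟩ => h2 rfl⟩

lemma lineOf_fst_ne {F : Type*} [Field F] {t : F} {P Q : F × F × F}
    (h : lineOf t P = lineOf t Q) (hne : P ≠ Q) : P.1 - Q.1 ≠ 0 := by
  intro h0
  apply hne
  have hx : P.1 = Q.1 := sub_eq_zero.mp h0
  simp only [lineOf, Prod.mk.injEq, hx, sub_left_inj] at h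
  exact Prod.ext hx (Prod.ext h.1 h.2)

lemma lineOf_unique {F : Type*} [Field F] {t s : F} {P Q : F × F × F}
    (h : lineOf t P = lineOf t Q) (h' : lineOf s P = lineOf s Q) (hne : P ≠ Q) : t = s := by
  have h0 := lineOf_fst_ne h hne
  simp only [lineOf, Prod.mk.injEq] at h h'
  have : (t - s) * (P.1 - Q.1) = 0 := by linear_combination h'.1 - h.1
  rcases mul_eq_zero.mp this with h | h
  · exact sub_eq_zero.mp h
  · exact absurd h h0

lemma lineOf_triangle {F : Type*} [Field F] {t1 t2 t3 : F} {P Q R : F × F × F}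
    (h1 : lineOf t1 P = lineOf t1 Q) (h2 : lineOf t2 Q = lineOf t2 R)
    (h3 : lineOf t3 P = lineOf t3 R) (n1 : P ≠ Q) (n2 : Q ≠ R) (n3 : P ≠ R) : t3 = t1 := by
  have u0 := lineOf_fst_ne h1 n1
  have v0 := lineOf_fst_ne h2 n2
  have w0 := lineOf_fst_ne h3 n3
  simp only [lineOf, Prod.mk.injEq] at h1 h2 h3
  have e1 : (t1 - t3) * (P.1 - Q.1) + (t2 - t3) * (Q.1 - R.1) = 0 := by
    linear_combination h3.1 - h1.1 - h2.1
  have e2 : (t1 ^ 2 - t3 ^ 2) * (P.1 - Q.1) + (t2 ^ 2 - t3 ^ 2) * (Q.1 - R.1) = 0 := by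
    linear_combination h3.2 - h1.2 - h2.2
  have e3 : (t2 - t3) * (t2 - t1) * (Q.1 - R.1) = 0 := by
    linear_combination e2 - (t1 + t3) * e1
  rcases mul_eq_zero.mp e3 with h | h
  · rcases mul_eq_zero.mp h with h | h
    · rw [h, zero_mul, add_zero] at e1
      rcases mul_eq_zero.mp e1 with h | h
      · exact (sub_eq_zero.mp h).symm
      · exact absurd h u0
    · have e4 : (t1 - t3) * (P.1 - R.1) = 0 := by
        linear_combination e1 - h * (Q.1 - R.1)
      rcases mul_eq_zero.mp e4 with h | h
      · exact (sub_eq_zero.mp h).symm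
      · exact absurd h w0
  · exact absurd h v0

lemma colGraph_cliqueFree {F : Type*} [Field F] {ℓ : ℕ} (hℓ : 2 ≤ ℓ)
    (χ : F × (F × F × F) → Fin ℓ) : (colGraph χ).CliqueFree (ℓ + 1) := by
  classical
  intro S hS
  obtain ⟨hc, hcard⟩ := hS
  obtain ⟨P, hP, Q, hQ, hPQ⟩ := Finset.one_lt_card.mp (show 1 < S.card by omega)
  obtain ⟨t, ht, -⟩ := hc hP hQ hPQ
  have key : ∀ R ∈ S, lineOf t P = lineOf t R := by
    intro R hR
    by_cases h1 : P = R
    · rw [h1]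
    by_cases h2 : Q = R
    · rw [← h2, ht]
    obtain ⟨t2, ht2, -⟩ := hc hQ hR h2
    obtain ⟨t3, ht3, -⟩ := hc hP hR h1
    have := lineOf_triangle ht ht2 ht3 hPQ h2 h1
    rw [← this]; exact ht3
  have hinj : Set.InjOn (fun R => χ (t, R)) (S : Set (F × F × F)) := by
    intro R hR R' hR' h
    by_contra hne
    obtain ⟨s, hs, hs'⟩ := hc hR hR' hne
    have : t = s := lineOf_unique ((key R hR).symm.trans (key R' hR')) hs hne
    subst this
    exact hs' h
  have := Finset.card_le_card_of_injOn (t := (Finset.univ : Finset (Fin ℓ)))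
    (fun R => χ (t, R)) (fun _ _ => Finset.mem_univ _) hinj
  rw [Finset.card_univ, Fintype.card_fin] at this
  omega

lemma colGraph_free {F : Type*} [Field F] {ℓ : ℕ}
    (χ : F × (F × F × F) → Fin ℓ) (A : Finset (F × F × F))
    (hA : ∀ S ⊆ A, ¬ (colGraph χ).IsNClique ℓ S) :
    ∃ g : F × (F × F) → Fin ℓ, ∀ t, ∀ P ∈ A, χ (t, P) ≠ g (t, lineOf t P) := by
  classical
  by_contra hcon
  have : ∃ tL : F × (F × F), ∀ c : Fin ℓ, ∃ P ∈ A, lineOf tL.1 P = tL.2 ∧ χ (tL.1, P) = c := by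
    by_contra h
    push Not at h
    choose g hg using h
    exact hcon ⟨g, fun t P hP => hg (t, lineOf t P) P hP rfl⟩
  obtain ⟨⟨t, L⟩, h⟩ := this
  choose f hf hL hχ using h
  simp only at hL hχ
  have finj : Function.Injective f := by
    intro a b hab
    rw [← hχ a, ← hχ b, hab]
  refine hA (Finset.univ.image f) ?_ ⟨?_, ?_⟩
  · intro x hx
    obtain ⟨c, -, rfl⟩ := Finset.mem_image.mp hx
    exact hf c
  · intro x hx y hy hxy
    obtain ⟨c, -, rfl⟩ := Finset.mem_image.mp (Finset.mem_coe.mp hx)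
    obtain ⟨d, -, rfl⟩ := Finset.mem_image.mp (Finset.mem_coe.mp hy)
    refine ⟨t, (hL c).trans (hL d).symm, ?_⟩
    rw [hχ, hχ]
    rintro rfl
    exact hxy rfl
  · rw [Finset.card_image_of_injective _ finj]; simp

lemma card_avoid {I : Type*} [Fintype I] [DecidableEq I] {ℓ : ℕ} (T : Finset I) (g : I → Fin ℓ) :
    (Fintype.piFinset (fun i => if i ∈ T then Finset.univ.erase (g i) else Finset.univ)).card
      * ℓ ^ T.card = (ℓ - 1) ^ T.card * ℓ ^ Fintype.card I := by
  rw [Fintype.card_piFinset]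
  have : ∀ i, (if i ∈ T then Finset.univ.erase (g i) else (Finset.univ : Finset (Fin ℓ))).card
      = if i ∈ T then ℓ - 1 else ℓ := by
    intro i; split_ifs <;> simp
  simp only [this]
  rw [Finset.prod_ite]
  simp only [Finset.prod_const, Finset.filter_mem_eq_inter, Finset.univ_inter]
  rw [mul_assoc, ← pow_add]
  congr 2
  have h := Finset.card_filter_add_card_filter_not (s := (Finset.univ : Finset I)) (fun i => i ∈ T)
  simp only [Finset.filter_mem_eq_inter, Finset.univ_inter, Finset.card_univ] at h
  omega

lemma exists_col (ℓ C q : ℕ) (hℓ : 2 ≤ ℓ) (hC : 2 * ℓ * (ℓ - 1) ^ C ≤ ℓ ^ C)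
    {F : Type*} [Field F] [Fintype F] (hq : Fintype.card F = q) :
    ∃ χ : F × (F × F × F) → Fin ℓ, ∀ A : Finset (F × F × F),
      (∀ S ⊆ A, ¬ (colGraph χ).IsNClique ℓ S) → A.card ≤ C * q ^ 2 := by
  classical
  by_contra hcon
  push Not at hcon
  have hqpos : 0 < q := hq ▸ Fintype.card_pos
  set a := C * q ^ 2 + 1 with ha
  let bad : Finset (F × F × F) × (F × (F × F) → Fin ℓ) → Finset (F × (F × F × F) → Fin ℓ) :=
    fun Ag => Fintype.piFinset (fun i => if i ∈ (Finset.univ : Finset F) ×ˢ Ag.1 then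
      Finset.univ.erase (Ag.2 (i.1, lineOf i.1 i.2)) else Finset.univ)
  let idx : Finset (Finset (F × F × F) × (F × (F × F) → Fin ℓ)) :=
    (Finset.powersetCard a Finset.univ) ×ˢ Finset.univ
  have hcover : (Finset.univ : Finset (F × (F × F × F) → Fin ℓ)) ⊆ idx.biUnion bad := by
    intro χ _
    obtain ⟨A, hA, hcard⟩ := hcon χ
    obtain ⟨B, hBA, hB⟩ := Finset.exists_subset_card_eq (show a ≤ A.card from hcard)
    obtain ⟨g, hg⟩ := colGraph_free χ B (fun S hS => hA S (hS.trans hBA))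
    refine Finset.mem_biUnion.mpr ⟨(B, g), ?_, ?_⟩
    · simp [idx, hB]
    · refine Fintype.mem_piFinset.mpr ?_
      rintro ⟨t, P⟩
      by_cases hP : P ∈ B
      · simpa [hP] using hg t P hP
      · simp [hP]
  have hbad : ∀ Ag ∈ idx, (bad Ag).card * ℓ ^ (q * a) = (ℓ - 1) ^ (q * a) * ℓ ^ (q ^ 4) := by
    rintro ⟨A, g⟩ hAg
    have hA : A.card = a := by
      have := (Finset.mem_product.mp hAg).1
      exact (Finset.mem_powersetCard.mp this).2
    have := card_avoid ((Finset.univ : Finset F) ×ˢ A) (fun i => g (i.1, lineOf i.1 i.2))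
    rw [Finset.card_product, Finset.card_univ, hq, hA] at this
    have hc : Fintype.card (F × F × F × F) = q ^ 4 := by
      simp only [Fintype.card_prod, hq]; ring
    rw [hc] at this
    exact this
  have hidx : idx.card ≤ (2 * ℓ) ^ (q ^ 3) := by
    rw [Finset.card_product, mul_pow]
    apply Nat.mul_le_mul
    · refine (Finset.card_le_univ _).trans ?_
      rw [Fintype.card_finset]
      simp only [Fintype.card_prod, hq]
      exact le_of_eq (by ring)
    · rw [Finset.card_univ, Fintype.card_fun, Fintype.card_fin]
      simp only [Fintype.card_prod, hq]
      exact le_of_eq (by ring)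
  have htot : ℓ ^ (q ^ 4) ≤ ∑ Ag ∈ idx, (bad Ag).card := by
    have := (Finset.card_le_card hcover).trans Finset.card_biUnion_le
    rw [Finset.card_univ, Fintype.card_fun, Fintype.card_fin] at this
    simp only [Fintype.card_prod, hq] at this
    calc ℓ ^ (q ^ 4) = ℓ ^ (q * (q * (q * q))) := by ring
      _ ≤ _ := this
  have h1 : ℓ ^ (q ^ 4) * ℓ ^ (q * a) ≤ (2 * ℓ) ^ (q ^ 3) * ((ℓ - 1) ^ (q * a) * ℓ ^ (q ^ 4)) := by
    calc ℓ ^ (q ^ 4) * ℓ ^ (q * a) ≤ (∑ Ag ∈ idx, (bad Ag).card) * ℓ ^ (q * a) :=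
          Nat.mul_le_mul_right _ htot
      _ = idx.card * ((ℓ - 1) ^ (q * a) * ℓ ^ (q ^ 4)) := by
          rw [Finset.sum_mul, Finset.sum_congr rfl hbad, Finset.sum_const, smul_eq_mul]
      _ ≤ _ := Nat.mul_le_mul_right _ hidx
  have hlpos : 0 < ℓ ^ (q ^ 4) := by positivity
  have h2 : ℓ ^ (q * a) ≤ (2 * ℓ) ^ (q ^ 3) * (ℓ - 1) ^ (q * a) := by
    refine Nat.le_of_mul_le_mul_left ?_ hlpos
    calc _ ≤ _ := h1
      _ = _ := by ring
  have hqa : q * a = C * q ^ 3 + q := by rw [ha]; ring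
  have h3 : (2 * ℓ) ^ (q ^ 3) * (ℓ - 1) ^ (q * a) < ℓ ^ (q * a) := by
    rw [hqa, pow_add, pow_add, ← mul_assoc, pow_mul, pow_mul, ← mul_pow]
    have hlt : (ℓ - 1) ^ q < ℓ ^ q := Nat.pow_lt_pow_left (by omega) hqpos.ne'
    exact Nat.mul_lt_mul_of_le_of_lt (Nat.pow_le_pow_left hC _) hlt (by positivity)
  omega

lemma exists_C (ℓ : ℕ) (hℓ : 2 ≤ ℓ) : ∃ C : ℕ, 2 * ℓ * (ℓ - 1) ^ C ≤ ℓ ^ C := by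
  obtain ⟨k, rfl⟩ : ∃ k, ℓ = k + 1 := ⟨ℓ - 1, by omega⟩
  have hk : (0 : ℝ) < k := by exact_mod_cast (show 0 < k by omega)
  have h1 : (1 : ℝ) < ((k : ℝ) + 1) / k := by rw [lt_div_iff₀ hk]; linarith
  obtain ⟨C, hC⟩ := pow_unbounded_of_one_lt (2 * ((k : ℝ) + 1)) h1
  refine ⟨C, ?_⟩
  rw [div_pow, lt_div_iff₀ (by positivity)] at hC
  rw [Nat.add_sub_cancel]
  exact_mod_cast hC.le

/-- For every `ℓ ≥ 2`, every `0 < γ < (ℓ−1)/(ℓ²+2ℓ)` and all sufficiently large `n`,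
there is an `n`-vertex `K_{ℓ+1}`-free graph `G` with `α_ℓ(G) ≤ n^{1−γ}`: every vertex
subset inducing a `K_ℓ`-free subgraph has size at most `n^{1−γ}`. -/
theorem stmt_10 (ℓ : ℕ) (hℓ : 2 ≤ ℓ) (γ : ℝ) (hγ0 : 0 < γ)
    (hγ : γ < ((ℓ : ℝ) - 1) / ((ℓ : ℝ) ^ 2 + 2 * ℓ)) :
    ∃ N : ℕ, ∀ n : ℕ, N ≤ n →
      ∃ G : SimpleGraph (Fin n), G.CliqueFree (ℓ + 1) ∧
        ∀ A : Finset (Fin n), (∀ S ⊆ A, ¬ G.IsNClique ℓ S) →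
          (A.card : ℝ) ≤ (n : ℝ) ^ ((1 : ℝ) - γ) := by
  classical
  have hl2 : (2 : ℝ) ≤ ℓ := by exact_mod_cast hℓ
  have hγ3 : γ < 1 / 3 := by
    refine hγ.trans ?_
    rw [div_lt_div_iff₀ (by positivity) (by norm_num)]
    nlinarith
  obtain ⟨C, hC⟩ := exists_C ℓ hℓ
  have htend : Filter.Tendsto (fun n : ℕ => (n : ℝ) ^ (1 / 3 - γ)) Filter.atTop Filter.atTop :=
    (tendsto_rpow_atTop (by linarith)).comp tendsto_natCast_atTop_atTop
  obtain ⟨N, hN⟩ := Filter.eventually_atTop.mp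
    ((htend.eventually_ge_atTop (16 * (C : ℝ))).and (Filter.eventually_ge_atTop 1))
  refine ⟨N, fun n hn => ?_⟩
  obtain ⟨hbig, hn1⟩ := hN n hn
  have hn1' : (1 : ℝ) ≤ n := by exact_mod_cast hn1
  set r : ℝ := (n : ℝ) ^ (1 / 3 : ℝ) with hr
  have hr1 : 1 ≤ r := Real.one_le_rpow hn1' (by norm_num)
  have hr3 : r ^ 3 = n := by
    rw [hr, ← Real.rpow_natCast, ← Real.rpow_mul (by positivity)]; norm_num
  set m := ⌈r⌉₊ with hm
  have hrm : r ≤ m := Nat.le_ceil r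
  have hmr : (m : ℝ) ≤ 2 * r := by
    have := Nat.ceil_lt_add_one (show 0 ≤ r by linarith)
    linarith
  have hm0 : m ≠ 0 := by
    intro h; rw [h] at hrm; norm_num at hrm; linarith
  obtain ⟨q, hqp, hmq, hq2⟩ := Nat.exists_prime_lt_and_le_two_mul m hm0
  have : Fact q.Prime := ⟨hqp⟩
  have hmq' : (m : ℝ) ≤ q := by exact_mod_cast hmq.le
  have hq4 : (q : ℝ) ≤ 4 * r := by
    have : (q : ℝ) ≤ 2 * m := by exact_mod_cast hq2
    linarith
  have hnq : n ≤ q ^ 3 := by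
    have : (n : ℝ) ≤ (q : ℝ) ^ 3 := by
      rw [← hr3]
      exact pow_le_pow_left₀ (by linarith) (hrm.trans hmq') 3
    exact_mod_cast this
  obtain ⟨χ, hχ⟩ := exists_col ℓ C q hℓ hC (F := ZMod q) (ZMod.card q)
  have hemb : Nonempty (Fin n ↪ ZMod q × ZMod q × ZMod q) := by
    apply Function.Embedding.nonempty_of_card_le
    simp only [Fintype.card_fin, Fintype.card_prod, ZMod.card]
    calc n ≤ q ^ 3 := hnq
      _ = _ := by ring
  obtain ⟨e⟩ := hemb
  refine ⟨(colGraph χ).comap e, ?_, ?_⟩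
  · exact SimpleGraph.CliqueFree.comap ⟨(SimpleGraph.Embedding.comap e (colGraph χ)).toCopy⟩ (colGraph_cliqueFree hℓ χ)
  · intro A hA
    have hle : (A.map e).card ≤ C * q ^ 2 := by
      apply hχ
      intro S hS hcl
      obtain ⟨B, hBA, rfl⟩ := Finset.subset_map_iff.mp hS
      refine hA B hBA ⟨?_, ?_⟩
      · intro x hx y hy hxy
        exact hcl.1 (Finset.mem_coe.mpr (Finset.mem_map_of_mem e hx))
          (Finset.mem_coe.mpr (Finset.mem_map_of_mem e hy)) (e.injective.ne hxy)
      · rw [← hcl.2, Finset.card_map]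
    rw [Finset.card_map] at hle
    have hle' : (A.card : ℝ) ≤ C * (q : ℝ) ^ 2 := by exact_mod_cast hle
    have hr2 : r ^ 2 = (n : ℝ) ^ (2 / 3 : ℝ) := by
      rw [hr, ← Real.rpow_natCast, ← Real.rpow_mul (by positivity)]; norm_num
    calc (A.card : ℝ) ≤ C * (q : ℝ) ^ 2 := hle'
      _ ≤ C * (4 * r) ^ 2 := by gcongr
      _ = 16 * C * r ^ 2 := by ring
      _ ≤ (n : ℝ) ^ (1 / 3 - γ) * r ^ 2 := by gcongr
      _ = (n : ℝ) ^ ((1 : ℝ) - γ) := by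
          rw [hr2, ← Real.rpow_add (by linarith)]; congr 1; ring
end

section
/- Fix integers r > ℓ ≥ 2 and constants η ∈ (0, (r−ℓ)/r) and γ ∈ (0, (ℓ−1)/(ℓ²+2ℓ)). Set μ = (r/(r−ℓ))·((r−ℓ)/r − η). Then for all sufficiently large n there exists an n-vertex graph G with δ(G) ≥ ηn and α_ℓ(G) < n^{1−γ} such that every K_r-tiling in G covers at most (1−μ)n vertices. -/
open Finset in
lemma aux_bad_card {P : Type*} [Fintype P] [DecidableEq P] (ℓ : ℕ) (hℓ : 1 ≤ ℓ) (B : Finset P) :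
    (((univ : Finset (P → Fin ℓ)).filter (fun f => ¬ ∀ i, ∃ x ∈ B, f x = i)).card : ℝ)
      ≤ (ℓ : ℝ) * ((ℓ : ℝ) ^ (Fintype.card P) * (1 - 1 / (ℓ : ℝ)) ^ B.card) := by
  have hsub : (univ : Finset (P → Fin ℓ)).filter (fun f => ¬ ∀ i, ∃ x ∈ B, f x = i) ⊆
      (univ : Finset (Fin ℓ)).biUnion (fun i => Fintype.piFinset
        (fun x => if x ∈ B then (univ : Finset (Fin ℓ)).erase i else univ)) := by
    intro f hf
    simp only [mem_filter, mem_univ, true_and, not_forall, not_exists, not_and] at hf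
    obtain ⟨i, hi⟩ := hf
    simp only [mem_biUnion, mem_univ, true_and, Fintype.mem_piFinset]
    refine ⟨i, fun x => ?_⟩
    by_cases hx : x ∈ B
    · simp [hx, hi x hx]
    · simp [hx]
  have h1 := (card_le_card hsub).trans card_biUnion_le
  have hℓ0 : (ℓ : ℝ) ≠ 0 := by positivity
  have h2 : ∀ i : Fin ℓ, ((Fintype.piFinset
        (fun x : P => if x ∈ B then (univ : Finset (Fin ℓ)).erase i else univ)).card : ℝ)
        = (ℓ : ℝ) ^ (Fintype.card P) * (1 - 1 / (ℓ : ℝ)) ^ B.card := by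
    intro i
    rw [Fintype.card_piFinset]
    push_cast
    have : ∀ x : P, (((if x ∈ B then (univ : Finset (Fin ℓ)).erase i else univ).card : ℕ) : ℝ)
        = (ℓ : ℝ) * (if x ∈ B then (1 - 1 / (ℓ : ℝ)) else 1) := by
      intro x
      split_ifs
      · rw [card_erase_of_mem (mem_univ _), card_univ, Fintype.card_fin, Nat.cast_sub hℓ]
        field_simp
        simp
      · simp
    rw [prod_congr rfl (fun x _ => this x), prod_mul_distrib]
    simp
  calc _ ≤ ((∑ i : Fin ℓ, (Fintype.piFinset
        (fun x : P => if x ∈ B then (univ : Finset (Fin ℓ)).erase i else univ)).card : ℕ) : ℝ) := by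
        exact_mod_cast h1
    _ = _ := by
      push_cast
      rw [sum_congr rfl (fun i _ => h2 i)]
      simp

/-- incidence of points and lines -/
def auxInc {F : Type*} [Field F] (x y : F × F × F) : Prop :=
  x.2.1 + y.2.1 = x.1 * y.1 ∧ x.2.2 + y.2.2 = x.1 * y.2.1

lemma auxInc_fst_ne {F : Type*} [Field F] {x x' y : F × F × F} (h : auxInc x y)
    (h' : auxInc x' y) (hne : x ≠ x') : x.1 - x'.1 ≠ 0 := by
  intro h0
  apply hne
  have e : x.1 = x'.1 := sub_eq_zero.mp h0
  obtain ⟨h1, h2⟩ := h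
  obtain ⟨h3, h4⟩ := h'
  refine Prod.ext e (Prod.ext ?_ ?_)
  · rw [e] at h1; linear_combination h1 - h3
  · rw [e] at h2; linear_combination h2 - h4

lemma auxInc_line_eq {F : Type*} [Field F] {x y y' : F × F × F} (h : auxInc x y)
    (h' : auxInc x y') (e : y.1 = y'.1) : y = y' := by
  obtain ⟨h1, h2⟩ := h
  obtain ⟨h3, h4⟩ := h'
  have e2 : y.2.1 = y'.2.1 := by rw [e] at h1; linear_combination h1 - h3
  refine Prod.ext e (Prod.ext e2 ?_)
  rw [e2] at h2; linear_combination h2 - h4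

lemma auxInc_unique {F : Type*} [Field F] {x x' y y' : F × F × F} (hne : x ≠ x')
    (h1 : auxInc x y) (h2 : auxInc x' y) (h3 : auxInc x y') (h4 : auxInc x' y') : y = y' := by
  apply auxInc_line_eq h1 h3
  have h0 := auxInc_fst_ne h1 h2 hne
  have : (x.1 - x'.1) * (y.1 - y'.1) = 0 := by
    linear_combination -h1.1 + h2.1 + h3.1 - h4.1
  exact sub_eq_zero.mp ((mul_eq_zero.mp this).resolve_left h0)

lemma auxInc_triangle {F : Type*} [Field F] {x x' z y y' y'' : F × F × F} (hxx : x ≠ x')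
    (hxz : x ≠ z)
    (h1 : auxInc x y) (h2 : auxInc x' y) (h3 : auxInc x' y') (h4 : auxInc z y')
    (h5 : auxInc x y'') (h6 : auxInc z y'') : auxInc z y := by
  have ha := auxInc_fst_ne h1 h2 hxx
  have hb := auxInc_fst_ne h5 h6 hxz
  have e : (x.1 - z.1) * (y.1 - y''.1) = (x'.1 - z.1) * (y.1 - y'.1) := by
    linear_combination -h1.1 + h2.1 - h3.1 + h4.1 + h5.1 - h6.1
  have e2 : (x.1 - z.1) * (y.2.1 - y''.2.1) = (x'.1 - z.1) * (y.2.1 - y'.2.1) := by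
    linear_combination -h1.2 + h2.2 - h3.2 + h4.2 + h5.2 - h6.2
  have e3 : y.2.1 - y''.2.1 = x.1 * (y.1 - y''.1) := by linear_combination h1.1 - h5.1
  have e4 : y.2.1 - y'.2.1 = x'.1 * (y.1 - y'.1) := by linear_combination h2.1 - h3.1
  rw [e3, e4] at e2
  have : (x.1 - x'.1) * ((x.1 - z.1) * (y.1 - y''.1)) = 0 := by
    linear_combination e2 - x'.1 * e
  have h7 := (mul_eq_zero.mp ((mul_eq_zero.mp this).resolve_left ha)).resolve_left hb
  rw [auxInc_line_eq h1 h5 (sub_eq_zero.mp h7)]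
  exact h6

/-- the random graph -/
def auxGraph {F : Type*} [Field F] {ℓ : ℕ} (c : F × F × F → F × F × F → Fin ℓ) :
    SimpleGraph (F × F × F) where
  Adj x x' := ∃ y, auxInc x y ∧ auxInc x' y ∧ c y x ≠ c y x'
  symm := ⟨fun _ _ ⟨y, h1, h2, h3⟩ => ⟨y, h2, h1, h3.symm⟩⟩
  loopless := ⟨fun _ ⟨_, _, _, h⟩ => h rfl⟩

lemma auxGraph_cliqueFree {F : Type*} [Field F] {ℓ : ℕ} (hℓ : 2 ≤ ℓ)
    (c : F × F × F → F × F × F → Fin ℓ) : (auxGraph c).CliqueFree (ℓ + 1) := by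
  intro S hS
  obtain ⟨hS, hc⟩ := hS
  obtain ⟨x, hx, x', hx', hne⟩ := Finset.one_lt_card.mp (by omega : 1 < S.card)
  obtain ⟨y, h1, h2, -⟩ := hS hx hx' hne
  have hall : ∀ z ∈ S, auxInc z y := by
    intro z hz
    by_cases e1 : z = x
    · exact e1 ▸ h1
    by_cases e2 : z = x'
    · exact e2 ▸ h2
    obtain ⟨y', h3, h4, -⟩ := hS hx' hz (Ne.symm e2)
    obtain ⟨y'', h5, h6, -⟩ := hS hx hz (Ne.symm e1)
    exact auxInc_triangle hne (Ne.symm e1) h1 h2 h3 h4 h5 h6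
  have hinj : Set.InjOn (c y) (S : Set (F × F × F)) := by
    intro z hz w hw hzw
    by_contra hne'
    obtain ⟨y', h3, h4, h5⟩ := hS hz hw hne'
    have := auxInc_unique hne' h3 h4 (hall z hz) (hall w hw)
    subst this
    exact h5 hzw
  have := Finset.card_le_card_of_injOn (t := Finset.univ) (c y) (fun _ _ => Finset.mem_univ _) hinj
  simp at this
  omega

open Finset Classical in
lemma aux_exists (p ℓ : ℕ) [Fact p.Prime] (hℓ : 2 ≤ ℓ) :
    ∃ H : SimpleGraph (ZMod p × ZMod p × ZMod p), H.CliqueFree (ℓ + 1) ∧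
      ∀ U : Finset (ZMod p × ZMod p × ZMod p), (∀ S ⊆ U, ¬ H.IsNClique ℓ S) →
        U.card ≤ 2 * ℓ ^ 2 * p ^ 2 := by
  set P := ZMod p × ZMod p × ZMod p with hP
  have hp : 0 < p := (Fact.out : p.Prime).pos
  have hcard : Fintype.card P = p ^ 3 := by
    simp [hP, ZMod.card]; ring
  suffices ∃ c : P → P → Fin ℓ, ∀ U : Finset P, 2 * ℓ ^ 2 * p ^ 2 < U.card →
      ∃ y, ∀ i, ∃ x ∈ U.filter (fun x => auxInc x y), c y x = i by
    obtain ⟨c, hc⟩ := this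
    refine ⟨auxGraph c, auxGraph_cliqueFree hℓ c, fun U hU => ?_⟩
    by_contra hlt
    obtain ⟨y, hy⟩ := hc U (by omega)
    choose g hg hgi using hy
    have ginj : Function.Injective g := by
      intro i j hij
      rw [← hgi i, ← hgi j, hij]
    apply hU (univ.image g)
    · intro x hx
      obtain ⟨i, -, rfl⟩ := mem_image.mp hx
      exact (mem_filter.mp (hg i)).1
    · refine ⟨?_, by rw [card_image_of_injective _ ginj]; simp⟩
      intro a ha b hb hab
      simp only [coe_image, coe_univ, Set.image_univ, Set.mem_range] at ha hb
      obtain ⟨i, rfl⟩ := ha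
      obtain ⟨j, rfl⟩ := hb
      refine ⟨y, (mem_filter.mp (hg i)).2, (mem_filter.mp (hg j)).2, ?_⟩
      rw [hgi, hgi]
      rintro rfl
      exact hab rfl
  by_contra hcon
  push Not at hcon
  set M := p ^ 3 with hM
  have hdeg : ∀ x : P, (univ.filter (fun y : P => auxInc x y)).card = p := by
    intro x
    have : univ.filter (fun y : P => auxInc x y) =
        (univ : Finset (ZMod p)).image
          (fun t => ((t, x.1 * t - x.2.1, x.1 * (x.1 * t - x.2.1) - x.2.2) : P)) := by
      ext y
      rw [mem_filter, mem_image]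
      simp only [mem_univ, true_and]
      unfold auxInc
      constructor
      · rintro ⟨h1, h2⟩
        have e : x.1 * y.1 - x.2.1 = y.2.1 := by linear_combination -h1
        refine ⟨y.1, Prod.ext rfl (Prod.ext e ?_)⟩
        simp only [e]
        linear_combination -h2
      · rintro ⟨t, rfl⟩
        constructor <;> simp
    rw [this, card_image_of_injective, card_univ, ZMod.card]
    intro a b hab
    exact congrArg Prod.fst hab
  have hdc : ∀ U : Finset P, ∑ y : P, (U.filter (fun x => auxInc x y)).card = U.card * p := by
    intro U
    have := sum_card_bipartiteAbove_eq_sum_card_bipartiteBelow (s := U) (t := (univ : Finset P))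
      (fun x y => auxInc x y)
    simp only [bipartiteAbove, bipartiteBelow] at this
    rw [← this, sum_congr rfl (fun x _ => hdeg x)]
    simp
  let bad : Finset P → Finset (P → P → Fin ℓ) := fun U => Fintype.piFinset (fun y =>
    (univ : Finset (P → Fin ℓ)).filter (fun f => ¬ ∀ i, ∃ x ∈ U.filter (fun x => auxInc x y), f x = i))
  set big := (univ : Finset (Finset P)).filter (fun U => 2 * ℓ ^ 2 * p ^ 2 < U.card) with hbig
  have hcov : (univ : Finset (P → P → Fin ℓ)) ⊆ big.biUnion bad := by
    intro c _
    obtain ⟨U, hU, h⟩ := hcon c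
    simp only [mem_biUnion]
    refine ⟨U, by simp [hbig, hU], ?_⟩
    simp only [bad, Fintype.mem_piFinset]
    intro y
    obtain ⟨i, hi⟩ := h y
    simp only [mem_filter (s := univ), mem_univ, true_and]
    intro hh
    obtain ⟨x, hx, e⟩ := hh i
    exact hi x hx e
  have hℓR : (0 : ℝ) < ℓ := by positivity
  have hq0 : 0 ≤ 1 - 1 / (ℓ : ℝ) := by
    have : 1 / (ℓ : ℝ) ≤ 1 := by
      rw [div_le_one hℓR]; exact_mod_cast (by omega : 1 ≤ ℓ)
    linarith
  have hbadcard : ∀ U ∈ big, ((bad U).card : ℝ) ≤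
      ((ℓ : ℝ) ^ M) ^ M * ((ℓ : ℝ) ^ M * Real.exp (- (2 * ℓ * M))) := by
    intro U hU
    have hU' : 2 * ℓ ^ 2 * p ^ 2 < U.card := (mem_filter.mp hU).2
    simp only [bad]
    rw [Fintype.card_piFinset]
    push_cast
    calc _ ≤ ∏ y : P, (ℓ : ℝ) * ((ℓ : ℝ) ^ (Fintype.card P) *
            (1 - 1 / (ℓ : ℝ)) ^ (U.filter (fun x => auxInc x y)).card) := by
          apply prod_le_prod
          · intros; positivity
          · intro y _
            convert aux_bad_card ℓ (by omega) (U.filter (fun x => auxInc x y))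
      _ = ((ℓ : ℝ) ^ M) ^ M * ((ℓ : ℝ) ^ M * (1 - 1 / (ℓ : ℝ)) ^ (U.card * p)) := by
          rw [prod_mul_distrib, prod_mul_distrib,
            prod_pow_eq_pow_sum _ _ (1 - 1 / (ℓ : ℝ)), hdc]
          simp only [prod_const, card_univ, hcard]
          ring
      _ ≤ _ := by
          gcongr
          calc (1 - 1 / (ℓ : ℝ)) ^ (U.card * p) ≤ (Real.exp (-(1 / (ℓ : ℝ)))) ^ (U.card * p) := by
                gcongr
                have := Real.add_one_le_exp (-(1 / (ℓ : ℝ)))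
                linarith
            _ = Real.exp (-((U.card * p : ℕ) / (ℓ : ℝ))) := by
                rw [← Real.exp_nat_mul]; congr 1; ring
            _ ≤ _ := by
                apply Real.exp_le_exp.mpr
                apply neg_le_neg
                rw [le_div_iff₀ hℓR]
                have : 2 * ℓ ^ 2 * p ^ 2 * p ≤ U.card * p := Nat.mul_le_mul_right _ hU'.le
                have h' : ((2 * ℓ ^ 2 * p ^ 2 * p : ℕ) : ℝ) ≤ ((U.card * p : ℕ) : ℝ) := by
                  exact_mod_cast this
                refine le_trans (le_of_eq ?_) h'
                rw [hM]; push_cast; ring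
  have hbigcard : (big.card : ℝ) ≤ 2 ^ M := by
    have : big.card ≤ 2 ^ M := by
      refine (card_filter_le _ _).trans ?_
      rw [card_univ, Fintype.card_finset, hcard]
    exact_mod_cast this
  have h1 : (((univ : Finset (P → P → Fin ℓ)).card : ℕ) : ℝ) ≤ ∑ U ∈ big, ((bad U).card : ℝ) := by
    exact_mod_cast (card_le_card hcov).trans card_biUnion_le
  have h2 : (((univ : Finset (P → P → Fin ℓ)).card : ℕ) : ℝ) = ((ℓ : ℝ) ^ M) ^ M := by
    rw [card_univ, Fintype.card_fun, Fintype.card_fun, hcard, Fintype.card_fin]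
    push_cast; rfl
  rw [h2] at h1
  have h3 := h1.trans (sum_le_card_nsmul _ _ _ hbadcard)
  rw [nsmul_eq_mul] at h3
  have hA : (0 : ℝ) < ((ℓ : ℝ) ^ M) ^ M := by positivity
  have h4 : ((ℓ : ℝ) ^ M) ^ M ≤
      ((ℓ : ℝ) ^ M) ^ M * (2 ^ M * ((ℓ : ℝ) ^ M * Real.exp (- (2 * ℓ * M)))) := by
    refine h3.trans ?_
    rw [mul_left_comm]
    gcongr
  have h5 : 1 ≤ (2 : ℝ) ^ M * ((ℓ : ℝ) ^ M * Real.exp (- (2 * ℓ * M))) := by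
    by_contra hh
    push Not at hh
    have := mul_lt_mul_of_pos_left hh hA
    linarith
  have h6 : (2 : ℝ) ^ M * ((ℓ : ℝ) ^ M * Real.exp (- (2 * ℓ * M)))
      = (2 * ℓ * Real.exp (-(2 * ℓ))) ^ M := by
    rw [mul_pow, mul_pow, ← Real.exp_nat_mul, ← mul_assoc]
    congr 2; ring
  have h7 : 2 * (ℓ : ℝ) * Real.exp (-(2 * ℓ)) < 1 := by
    rw [Real.exp_neg, ← div_eq_mul_inv, div_lt_one (Real.exp_pos _)]
    have := Real.add_one_le_exp (2 * (ℓ : ℝ))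
    linarith
  rw [h6] at h5
  have h8 := pow_lt_one₀ (n := M) (by positivity) h7 (by positivity)
  linarith

lemma aux_threshold (ℓ : ℕ) (η γ : ℝ) (hη1 : η < 1) (hγ : γ < 1 / 3) :
    ∃ N : ℕ, ∀ n : ℕ, N ≤ n → 1 ≤ n ∧ 2 ≤ (1 - η) * n ∧
      32 * (ℓ : ℝ) ^ 2 * (n : ℝ) ^ (2 / 3 : ℝ) < (n : ℝ) ^ (1 - γ) := by
  have t1 : Filter.Tendsto (fun n : ℕ => (1 - η) * (n : ℝ)) Filter.atTop Filter.atTop :=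
    Filter.Tendsto.const_mul_atTop (by linarith) tendsto_natCast_atTop_atTop
  have t2 : Filter.Tendsto (fun n : ℕ => (n : ℝ) ^ (1 / 3 - γ)) Filter.atTop Filter.atTop :=
    (tendsto_rpow_atTop (by linarith)).comp tendsto_natCast_atTop_atTop
  have := ((Filter.eventually_ge_atTop 1).and ((t1.eventually_ge_atTop 2).and
    (t2.eventually_gt_atTop (32 * (ℓ : ℝ) ^ 2))))
  obtain ⟨N, hN⟩ := Filter.eventually_atTop.mp this
  refine ⟨N, fun n hn => ?_⟩
  obtain ⟨h1, h2, h3⟩ := hN n hn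
  refine ⟨h1, h2, ?_⟩
  have hn0 : (0 : ℝ) < n := by exact_mod_cast h1
  have : (n : ℝ) ^ (1 - γ) = (n : ℝ) ^ (1 / 3 - γ) * (n : ℝ) ^ (2 / 3 : ℝ) := by
    rw [← Real.rpow_add hn0]; congr 1; ring
  rw [this]
  have hpos : 0 < (n : ℝ) ^ (2 / 3 : ℝ) := Real.rpow_pos_of_pos hn0 _
  exact mul_lt_mul_of_pos_right h3 hpos

lemma aux_prime (n : ℕ) (hn : 1 ≤ n) : ∃ p : ℕ, p.Prime ∧ n ≤ p ^ 3 ∧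
    (p : ℝ) ^ 2 ≤ 16 * (n : ℝ) ^ (2 / 3 : ℝ) := by
  have hn1 : (1 : ℝ) ≤ n := by exact_mod_cast hn
  set t := (n : ℝ) ^ (1 / 3 : ℝ) with ht
  have ht1 : 1 ≤ t := Real.one_le_rpow hn1 (by norm_num)
  have ht3 : t ^ 3 = n := by
    rw [ht, ← Real.rpow_natCast, ← Real.rpow_mul (by linarith)]; norm_num
  have ht2 : t ^ 2 = (n : ℝ) ^ (2 / 3 : ℝ) := by
    rw [ht, ← Real.rpow_natCast, ← Real.rpow_mul (by linarith)]; norm_num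
  have hk := Nat.le_ceil t
  have hk' := Nat.ceil_lt_add_one (by linarith : 0 ≤ t)
  obtain ⟨p, hp, hp1, hp2⟩ := Nat.exists_prime_lt_and_le_two_mul ⌈t⌉₊ (by
    have := Nat.ceil_pos.mpr (by linarith : 0 < t); omega)
  have hp1' : (⌈t⌉₊ : ℝ) < p := by exact_mod_cast hp1
  have hp2' : (p : ℝ) ≤ 2 * ⌈t⌉₊ := by exact_mod_cast hp2
  refine ⟨p, hp, ?_, ?_⟩
  · have : t ^ 3 ≤ (p : ℝ) ^ 3 := by gcongr; linarith
    rw [ht3] at this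
    exact_mod_cast this
  · rw [← ht2]
    have : (p : ℝ) ≤ 4 * t := by linarith
    calc (p : ℝ) ^ 2 ≤ (4 * t) ^ 2 := by gcongr
      _ = _ := by ring

open Classical in
lemma aux_maximal {n ℓ m : ℕ} (hℓ : 2 ≤ ℓ) (hm : m + 2 ≤ n) (H : SimpleGraph (Fin n))
    (hH : H.CliqueFree (ℓ + 1)) :
    ∃ K : SimpleGraph (Fin n), H ≤ K ∧
      (∀ S : Finset (Fin n), (∀ x ∈ S, m ≤ x.val) → ¬ K.IsNClique (ℓ + 1) S) ∧
      (∀ v : Fin n, m ≤ v.val → ∃ c : Fin n, m ≤ c.val ∧ K.Adj v c) := by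
  obtain ⟨K, hHK, hK⟩ := Finite.exists_le_maximal (α := SimpleGraph (Fin n))
    (p := fun K => ∀ S : Finset (Fin n), (∀ x ∈ S, m ≤ x.val) → ¬ K.IsNClique (ℓ + 1) S)
    (a := H) (fun S _ => hH S)
  refine ⟨K, hHK, hK.prop, fun v hv => ?_⟩
  obtain ⟨w, hw, hvw⟩ : ∃ w : Fin n, m ≤ w.val ∧ v ≠ w := by
    by_cases h : v.val = m
    · exact ⟨⟨m + 1, by omega⟩, by simp, fun e => by rw [e] at h; simp at h⟩
    · exact ⟨⟨m, by omega⟩, by simp, fun e => h (by rw [e])⟩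
  by_contra hcon
  push Not at hcon
  have hnot : ¬ ∀ S : Finset (Fin n), (∀ x ∈ S, m ≤ x.val) →
      ¬ (K ⊔ SimpleGraph.edge v w).IsNClique (ℓ + 1) S := by
    intro hP
    have hle := hK.le_of_ge hP le_sup_left
    apply hcon w hw
    apply hle
    simp [SimpleGraph.sup_adj, SimpleGraph.edge_adj, hvw]
  push Not at hnot
  obtain ⟨S, hSm, hS⟩ := hnot
  have hvS : v ∈ S := by
    by_contra hvS
    apply hK.prop S hSm
    refine ⟨fun a ha b hb hab => ?_, hS.2⟩
    have := hS.1 ha hb hab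
    simp only [SimpleGraph.sup_adj, SimpleGraph.edge_adj] at this
    rcases this with h | ⟨⟨rfl, rfl⟩ | ⟨rfl, rfl⟩, -⟩
    · exact h
    · exact absurd ha hvS
    · exact absurd hb hvS
  obtain ⟨c, hc, hcv⟩ : ∃ c ∈ S, c ∉ ({v, w} : Finset (Fin n)) := by
    apply Finset.exists_mem_notMem_of_card_lt_card
    rw [hS.2]
    exact lt_of_le_of_lt Finset.card_le_two (by omega)
  simp only [Finset.mem_insert, Finset.mem_singleton, not_or] at hcv
  have := hS.1 hvS hc (Ne.symm hcv.1)
  simp only [SimpleGraph.sup_adj, SimpleGraph.edge_adj] at this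
  rcases this with h | ⟨⟨-, e⟩ | ⟨-, e⟩, -⟩
  · exact hcon c (hSm c hc) h
  · exact hcv.2 e
  · exact hcv.1 e


/-- Lower bound construction: for `r > ℓ ≥ 2`, `η ∈ (0,(r−ℓ)/r)`,
`γ ∈ (0,(ℓ−1)/(ℓ²+2ℓ))` and `μ = (r/(r−ℓ))((r−ℓ)/r − η)`, for all sufficiently
large `n` there is an `n`-vertex graph `G` with `δ(G) ≥ ηn` and `α_ℓ(G) < n^{1−γ}`
such that every `K_r`-tiling of `G` covers at most `(1−μ)n` vertices. -/
theorem stmt_11 (r ℓ : ℕ) (hℓ : 2 ≤ ℓ) (hrℓ : ℓ < r) (η γ μ : ℝ)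
    (hη0 : 0 < η) (hη1 : η < ((r : ℝ) - ℓ) / r)
    (hγ0 : 0 < γ) (hγ1 : γ < ((ℓ : ℝ) - 1) / ((ℓ : ℝ) ^ 2 + 2 * ℓ))
    (hμ : μ = ((r : ℝ) / ((r : ℝ) - ℓ)) * (((r : ℝ) - ℓ) / r - η)) :
    ∃ N : ℕ, ∀ n : ℕ, N ≤ n →
      ∃ G : SimpleGraph (Fin n), ∃ _ : DecidableRel G.Adj,
        (∀ v : Fin n, η * n ≤ (G.degree v : ℝ)) ∧
        (∀ A : Finset (Fin n), (∀ S ⊆ A, ¬ G.IsNClique ℓ S) →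
          (A.card : ℝ) < (n : ℝ) ^ ((1 : ℝ) - γ)) ∧
        (∀ T : Finset (Finset (Fin n)), (∀ S ∈ T, G.IsNClique r S) →
          (T : Set (Finset (Fin n))).Pairwise Disjoint →
          ((∑ S ∈ T, S.card : ℕ) : ℝ) ≤ (1 - μ) * n) := by
  classical
  have hℓ2 : (2 : ℝ) ≤ ℓ := by exact_mod_cast hℓ
  have hrl : (ℓ : ℝ) < r := by exact_mod_cast hrℓ
  have hη' : η < 1 := by
    refine hη1.trans_le ?_
    rw [div_le_one (by linarith)]; linarith
  have hγ' : γ < 1 / 3 := by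
    refine hγ1.trans_le ?_
    rw [div_le_div_iff₀ (by positivity) (by norm_num)]
    nlinarith
  obtain ⟨N, hN⟩ := aux_threshold ℓ η γ hη' hγ'
  refine ⟨N, fun n hn => ?_⟩
  obtain ⟨hn1, hn2, hn3⟩ := hN n hn
  obtain ⟨p, hp, hnp, hp2⟩ := aux_prime n hn1
  have : Fact p.Prime := ⟨hp⟩
  obtain ⟨H, hHf, hHα⟩ := aux_exists p ℓ hℓ
  obtain ⟨e⟩ : Nonempty (Fin n ↪ ZMod p × ZMod p × ZMod p) := by
    apply Function.Embedding.nonempty_of_card_le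
    simp only [Fintype.card_fin, Fintype.card_prod, ZMod.card]
    calc n ≤ p ^ 3 := hnp
      _ = _ := by ring
  set m := ⌊η * n⌋₊ with hm
  have hm1 : (m : ℝ) ≤ η * n := Nat.floor_le (by positivity)
  have hm2 : η * n < m + 1 := Nat.lt_floor_add_one _
  have hmn : m + 2 ≤ n := by
    have : (m : ℝ) + 2 ≤ n := by linarith
    exact_mod_cast this
  have hHc : (H.comap e).CliqueFree (ℓ + 1) :=
    hHf.comap (SimpleGraph.Embedding.comap e H).toCopy.isContained
  obtain ⟨K, hHK, hKf, hKd⟩ := aux_maximal hℓ hmn (H.comap e) hHc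
  let G : SimpleGraph (Fin n) :=
    { Adj := fun v w => v ≠ w ∧ (v.val < m ∨ w.val < m ∨ K.Adj v w)
      symm := ⟨fun v w h => ⟨h.1.symm, by
        rcases h.2 with h | h | h
        · exact Or.inr (Or.inl h)
        · exact Or.inl h
        · exact Or.inr (Or.inr h.symm)⟩⟩
      loopless := ⟨fun v h => h.1 rfl⟩ }
  have hcardX : (Finset.univ.filter (fun x : Fin n => x.val < m)).card = m := by
    rw [Fin.card_filter_val_lt]; omega
  have hdec : DecidableRel G.Adj := Classical.decRel _
  refine ⟨G, hdec, ?_, ?_, ?_⟩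
  · intro v
    suffices m + 1 ≤ G.degree v by
      have : (m : ℝ) + 1 ≤ (G.degree v : ℝ) := by exact_mod_cast this
      linarith
    rw [← SimpleGraph.card_neighborFinset_eq_degree]
    by_cases hv : v.val < m
    · have : (Finset.univ.erase v) ⊆ G.neighborFinset v := by
        intro w hw
        rw [SimpleGraph.mem_neighborFinset]
        exact ⟨(Finset.ne_of_mem_erase hw).symm, Or.inl hv⟩
      have h := Finset.card_le_card this
      rw [Finset.card_erase_of_mem (Finset.mem_univ _), Finset.card_univ, Fintype.card_fin] at h
      omega
    · obtain ⟨c, hc, hvc⟩ := hKd v (by omega)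
      have : insert c (Finset.univ.filter (fun x : Fin n => x.val < m)) ⊆ G.neighborFinset v := by
        intro w hw
        rw [SimpleGraph.mem_neighborFinset]
        rcases Finset.mem_insert.mp hw with rfl | hw
        · exact ⟨hvc.ne, Or.inr (Or.inr hvc)⟩
        · have hw' := (Finset.mem_filter.mp hw).2
          exact ⟨fun h => hv (h ▸ hw'), Or.inr (Or.inl hw')⟩
      have h := Finset.card_le_card this
      rw [Finset.card_insert_of_notMem (by simp; omega), hcardX] at h
      exact h
  · intro A hA
    have h1 := hHα (A.map e) (by
      intro S hS hcl
      obtain ⟨S', hS', rfl⟩ := Finset.subset_map_iff.mp hS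
      apply hA S' hS'
      refine ⟨fun a ha b hb hab => ⟨hab, Or.inr (Or.inr (hHK ?_))⟩, by simpa using hcl.2⟩
      rw [SimpleGraph.comap_adj]
      exact hcl.1 (by simpa using ha) (by simpa using hb) (fun h => hab (e.injective h)))
    rw [Finset.card_map] at h1
    have h2 : (A.card : ℝ) ≤ 2 * (ℓ : ℝ) ^ 2 * (p : ℝ) ^ 2 := by exact_mod_cast h1
    calc (A.card : ℝ) ≤ 2 * (ℓ : ℝ) ^ 2 * (p : ℝ) ^ 2 := h2
      _ ≤ 2 * (ℓ : ℝ) ^ 2 * (16 * (n : ℝ) ^ (2 / 3 : ℝ)) := by gcongr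
      _ = 32 * (ℓ : ℝ) ^ 2 * (n : ℝ) ^ (2 / 3 : ℝ) := by ring
      _ < _ := hn3
  · intro T hT hdisj
    have hS1 : ∀ S ∈ T, r - ℓ ≤ (S.filter (fun x : Fin n => x.val < m)).card := by
      intro S hS
      have hcl := hT S hS
      have h1 : (S.filter (fun x : Fin n => ¬ x.val < m)).card ≤ ℓ := by
        by_contra hlt
        obtain ⟨S', hS', hc⟩ := Finset.exists_subset_card_eq
          (by omega : ℓ + 1 ≤ (S.filter (fun x : Fin n => ¬ x.val < m)).card)
        refine hKf S' (fun x hx => by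
          have := (Finset.mem_filter.mp (hS' hx)).2
          omega) ⟨fun a ha b hb hab => ?_, hc⟩
        have ha' := Finset.mem_filter.mp (hS' ha)
        have hb' := Finset.mem_filter.mp (hS' hb)
        rcases (hcl.1 ha'.1 hb'.1 hab).2 with h | h | h
        · exact absurd h ha'.2
        · exact absurd h hb'.2
        · exact h
      have h2 := Finset.card_filter_add_card_filter_not (s := S) (fun x : Fin n => x.val < m)
      have h3 := hcl.2
      omega
    have hT1 : T.card * (r - ℓ) ≤ m := by
      calc T.card * (r - ℓ) ≤ ∑ S ∈ T, (S.filter (fun x : Fin n => x.val < m)).card := by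
            rw [← smul_eq_mul]; exact Finset.card_nsmul_le_sum _ _ _ hS1
        _ = (T.biUnion (fun S => S.filter (fun x : Fin n => x.val < m))).card := by
            rw [Finset.card_biUnion]
            intro S hS S' hS' hne
            exact Finset.disjoint_filter_filter (hdisj hS hS' hne)
        _ ≤ (Finset.univ.filter (fun x : Fin n => x.val < m)).card := by
            apply Finset.card_le_card
            intro x hx
            simp only [Finset.mem_biUnion, Finset.mem_filter] at hx
            obtain ⟨S, -, -, h⟩ := hx
            simp [h]
        _ = m := hcardX
    have hsum : ∑ S ∈ T, S.card = T.card * r := by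
      rw [Finset.sum_congr rfl (fun S hS => (hT S hS).2)]; simp
    rw [hsum]
    have h1 : (T.card : ℝ) * ((r : ℝ) - ℓ) ≤ m := by
      rw [← Nat.cast_sub hrℓ.le]; exact_mod_cast hT1
    have hd : (0 : ℝ) < (r : ℝ) - ℓ := by linarith
    have hr0 : (0 : ℝ) < r := by linarith
    have h2 : (T.card : ℝ) ≤ η * n / ((r : ℝ) - ℓ) := by
      rw [le_div_iff₀ hd]; linarith
    have h3 : (1 - μ) * n = η * n / ((r : ℝ) - ℓ) * r := by
      rw [hμ]; field_simp; ring
    rw [h3]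
    push_cast
    gcongr
end
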